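/- For every integer n ≥ 1, every convergent sequence in the moduli space 𝒳_n = F_n/PGL(2,ℂ) has a unique limit: if a sequence (z_m) in 𝒳_n converges both to l and to l*, then l = l*. -/

import Mathlib

/-!
Setup: for `n ≥ 1`, a rational function of degree `n` on `ℂP¹` is represented by a
coprime pair `(a, b)` of binary forms of degree `n` in variables `x₀, x₁`.  A binary form
of degree `n` is encoded by its coefficient vector `Fin (n+1) → ℂ`, the form being
`∑ i, a i * x₀ ^ i * x₁ ^ (n - i)`; thus the pair space is the `(2n+2)`-dimensional
complex vector space `(Fin (n+1) → ℂ) × (Fin (n+1) → ℂ)` with its standard (coefficient)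
topology.  `F_n` is the space of classes `[a : b]` of coprime pairs up to simultaneous
scaling (a subspace of `ℂP^{2n+1}`, here constructed directly as the quotient of the
coprime pairs by scaling, with the quotient topology — which agrees with the subspace
topology since the projectivization map is open and the coprime locus is saturated).
`PGL(2,ℂ)` acts on `F_n` on the right by precomposition `[a : b] · g = [a ∘ g : b ∘ g]`,
`(a ∘ g)(x) = a (x g)`; since scalar matrices act trivially on `F_n`, the orbit space
`𝒳_n = F_n / PGL(2,ℂ)` coincides with the quotient of `F_n` by the (right) action of
`GL(2,ℂ)` by substitution, which is how we construct it.  `𝒳_n` carries the quotient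
topology and `pr : F_n → 𝒳_n` is the quotient map.
-/

open Filter Topology

noncomputable section

/-- Coefficient vector of a binary form of degree `n` in `x₀, x₁`. -/
abbrev Coeffs (n : ℕ) := Fin (n + 1) → ℂ

/-- Value of the binary form with coefficient vector `a` at the point `x = (x 0, x 1)`. -/
def evalForm {n : ℕ} (a : Coeffs n) (x : Fin 2 → ℂ) : ℂ :=
  ∑ i : Fin (n + 1), a i * x 0 ^ (i : ℕ) * x 1 ^ (n - (i : ℕ))

/-- Two binary forms of degree `n` are coprime iff they have no common zero in `ℂ² \ {0}`. -/
def IsCoprimePair {n : ℕ} (a b : Coeffs n) : Prop :=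
  ∀ x : Fin 2 → ℂ, x ≠ 0 → (evalForm a x ≠ 0 ∨ evalForm b x ≠ 0)

/-- The space of coprime pairs of binary forms of degree `n`
(a subspace of the `(2n+2)`-dimensional coefficient space). -/
abbrev RatRep (n : ℕ) := { v : Coeffs n × Coeffs n // IsCoprimePair v.1 v.2 }

/-- Simultaneous rescaling of a coprime pair. -/
def scaleRel (n : ℕ) (u v : RatRep n) : Prop := ∃ c : ℂˣ, v.val = c • u.val

/-- `F_n`: the space of rational functions `[a : b]` of degree `n`, i.e. coprime pairs of
degree-`n` binary forms up to simultaneous scaling, with the quotient (= coefficient)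
topology. -/
abbrev Fn (n : ℕ) := Quot (scaleRel n)

open MvPolynomial in
/-- The binary form (as a polynomial in `MvPolynomial (Fin 2) ℂ`) with coefficient
vector `a`. -/
def toPoly {n : ℕ} (a : Coeffs n) : MvPolynomial (Fin 2) ℂ :=
  ∑ i : Fin (n + 1), C (a i) * X 0 ^ (i : ℕ) * X 1 ^ (n - (i : ℕ))

/-- The coefficient vector of (the degree-`n` homogeneous part of) a polynomial in two
variables. -/
def ofPoly (n : ℕ) (p : MvPolynomial (Fin 2) ℂ) : Coeffs n :=
  fun j => MvPolynomial.coeff (Finsupp.single 0 (j : ℕ) + Finsupp.single 1 (n - (j : ℕ))) p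

/-- Right substitution action: the coefficient vector of `a ∘ g`, where
`(a ∘ g)(x) = a (x g)`, i.e. the substitution `xⱼ ↦ ∑ i, g i j * xᵢ`. -/
def compForm {n : ℕ} (a : Coeffs n) (g : Matrix (Fin 2) (Fin 2) ℂ) : Coeffs n :=
  ofPoly n (MvPolynomial.bind₁
    (fun j => ∑ i : Fin 2, MvPolynomial.C (g i j) * MvPolynomial.X i) (toPoly a))

/-- `p` and `q` in `F_n` are related iff `q = p · g` for some `g ∈ GL(2,ℂ)`; the orbits of
this relation are exactly the orbits of the right `PGL(2,ℂ)`-action on `F_n`. -/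
def glRel (n : ℕ) (p q : Fn n) : Prop :=
  ∃ (u v : RatRep n) (g : GL (Fin 2) ℂ),
    Quot.mk (scaleRel n) u = p ∧ Quot.mk (scaleRel n) v = q ∧
    v.val = (compForm u.val.1 g.val, compForm u.val.2 g.val)

/-- The moduli space `𝒳_n = F_n / PGL(2,ℂ)` with the quotient topology. -/
abbrev Xn (n : ℕ) := Quot (glRel n)

/-- The quotient map `pr : F_n → 𝒳_n`. -/
def pr (n : ℕ) : Fn n → Xn n := Quot.mk (glRel n)

/-! ### Binary forms as functions -/

lemma evalForm_eq_eval {n : ℕ} (a : Coeffs n) (x : Fin 2 → ℂ) :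
    evalForm a x = MvPolynomial.eval x (toPoly a) := by
  simp [evalForm, toPoly]

lemma isHomogeneous_toPoly {n : ℕ} (a : Coeffs n) : (toPoly a).IsHomogeneous n := by
  refine MvPolynomial.IsHomogeneous.sum _ _ _ fun i _ => ?_
  have h := ((MvPolynomial.isHomogeneous_C (Fin 2) (a i)).mul
    ((MvPolynomial.isHomogeneous_X ℂ (0 : Fin 2)).pow (i : ℕ))).mul
    ((MvPolynomial.isHomogeneous_X ℂ (1 : Fin 2)).pow (n - (i : ℕ)))
  convert h using 1
  have := i.2
  omega

lemma evalForm_ofPoly {n : ℕ} {p : MvPolynomial (Fin 2) ℂ} (hp : p.IsHomogeneous n)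
    (x : Fin 2 → ℂ) : evalForm (ofPoly n p) x = MvPolynomial.eval x p := by
  classical
  let e : Fin (n + 1) → (Fin 2 →₀ ℕ) := fun j =>
    Finsupp.single 0 (j : ℕ) + Finsupp.single 1 (n - (j : ℕ))
  have he : Function.Injective e := fun i j h => by
    have := DFunLike.congr_fun h 0
    simpa [e, Fin.ext_iff] using this
  have hsupp : p.support ⊆ Finset.univ.image e := fun d hd => by
    have hdeg : d.degree = n := by
      by_contra hne
      exact MvPolynomial.mem_support_iff.1 hd (hp.coeff_eq_zero hne)
    rw [Finsupp.degree_eq_sum, Fin.sum_univ_two] at hdeg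
    refine Finset.mem_image.2 ⟨⟨d 0, by omega⟩, Finset.mem_univ _, ?_⟩
    ext k
    fin_cases k
    · simp [e]
    · simp [e]
      omega
  rw [MvPolynomial.eval_eq', Finset.sum_subset hsupp
    (fun d _ hd => by rw [MvPolynomial.notMem_support_iff.1 hd, zero_mul]),
    Finset.sum_image he.injOn]
  simp [evalForm, ofPoly, e, Fin.prod_univ_two, mul_assoc]

lemma evalForm_compForm {n : ℕ} (a : Coeffs n) (g : Matrix (Fin 2) (Fin 2) ℂ)
    (x : Fin 2 → ℂ) : evalForm (compForm a g) x = evalForm a (Matrix.vecMul x g) := by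
  have hlin : ∀ j : Fin 2, (∑ i : Fin 2, MvPolynomial.C (g i j) * MvPolynomial.X i :
      MvPolynomial (Fin 2) ℂ).IsHomogeneous 1 := fun j =>
    MvPolynomial.IsHomogeneous.sum _ _ _ fun i _ => by
      simpa using (MvPolynomial.isHomogeneous_C (Fin 2) (g i j)).mul
        (MvPolynomial.isHomogeneous_X ℂ i)
  have hhom := (isHomogeneous_toPoly a).aeval _ hlin
  rw [one_mul] at hhom
  rw [compForm, evalForm_ofPoly (by exact hhom), evalForm_eq_eval]
  simp only [toPoly, map_sum, map_mul, map_pow, MvPolynomial.bind₁_C_right,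
    MvPolynomial.bind₁_X_right, MvPolynomial.eval_C, MvPolynomial.eval_X, Matrix.vecMul,
    dotProduct, mul_comm]

lemma evalForm_injective {n : ℕ} {a b : Coeffs n} (h : ∀ x, evalForm a x = evalForm b x) :
    a = b := by
  have hpoly : (∑ i : Fin (n + 1), Polynomial.C (a i) * Polynomial.X ^ (i : ℕ)) =
      ∑ i : Fin (n + 1), Polynomial.C (b i) * Polynomial.X ^ (i : ℕ) :=
    Polynomial.funext fun t => by
      simpa [evalForm, Polynomial.eval_finsetSum] using h ![t, 1]
  ext j
  simpa [Polynomial.finsetSum_coeff, Polynomial.coeff_C_mul, Polynomial.coeff_X_pow,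
    ← Fin.ext_iff] using congrArg (fun p => Polynomial.coeff p (j : ℕ)) hpoly

lemma evalForm_smul_right {n : ℕ} (a : Coeffs n) (c : ℂ) (x : Fin 2 → ℂ) :
    evalForm a (c • x) = c ^ n * evalForm a x := by
  rw [evalForm, evalForm, Finset.mul_sum]
  refine Finset.sum_congr rfl fun i _ => ?_
  have hc : c ^ n = c ^ (i : ℕ) * c ^ (n - (i : ℕ)) := by
    rw [← pow_add, Nat.add_sub_cancel' (Nat.lt_succ_iff.1 i.2)]
  simp only [Pi.smul_apply, smul_eq_mul, mul_pow, hc]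
  ring

lemma evalForm_smul_left {n : ℕ} (c : ℂ) (a : Coeffs n) (x : Fin 2 → ℂ) :
    evalForm (c • a) x = c * evalForm a x := by
  simp [evalForm, Finset.mul_sum, mul_assoc]

lemma continuous_evalForm {n : ℕ} :
    Continuous fun p : Coeffs n × (Fin 2 → ℂ) => evalForm p.1 p.2 := by
  unfold evalForm
  fun_prop

lemma Filter.Tendsto.evalForm {n : ℕ} {ι : Type*} {l : Filter ι} {a : ι → Coeffs n}
    {a₀ : Coeffs n} {x : ι → Fin 2 → ℂ} {x₀ : Fin 2 → ℂ} (ha : Tendsto a l (𝓝 a₀))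
    (hx : Tendsto x l (𝓝 x₀)) :
    Tendsto (fun i => _root_.evalForm (a i) (x i)) l (𝓝 (_root_.evalForm a₀ x₀)) := by
  have h := (continuous_evalForm (n := n)).tendsto (a₀, x₀)
  have hcomp := Filter.Tendsto.comp h (ha.prodMk_nhds hx)
  exact hcomp

lemma continuous_compForm {n : ℕ} (g : Matrix (Fin 2) (Fin 2) ℂ) :
    Continuous fun a : Coeffs n => compForm a g := by
  refine continuous_pi fun j => ?_
  simp only [compForm, ofPoly, toPoly, map_sum, map_mul, MvPolynomial.bind₁_C_right, mul_assoc,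
    MvPolynomial.coeff_sum, MvPolynomial.coeff_C_mul]
  fun_prop

/-! ### The action of `GL(2,ℂ)` on coprime pairs -/

/-- Precomposition of a coprime pair with an invertible linear substitution. -/
def RatRep.comp {n : ℕ} (u : RatRep n) (g : GL (Fin 2) ℂ) : RatRep n :=
  ⟨(compForm u.1.1 g.val, compForm u.1.2 g.val), fun x hx => by
    simp only [evalForm_compForm]
    refine u.2 _ fun h => hx ?_
    have := congrArg (fun y => Matrix.vecMul y (g⁻¹).val) h
    simpa [Matrix.vecMul_vecMul, ← Units.val_mul] using this⟩

lemma RatRep.ext_evalForm {n : ℕ} {u v : RatRep n}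
    (h₁ : ∀ x, evalForm u.1.1 x = evalForm v.1.1 x)
    (h₂ : ∀ x, evalForm u.1.2 x = evalForm v.1.2 x) : u = v :=
  Subtype.ext (Prod.ext (evalForm_injective h₁) (evalForm_injective h₂))

lemma RatRep.comp_one {n : ℕ} (u : RatRep n) : u.comp 1 = u :=
  RatRep.ext_evalForm (fun x => by simp [RatRep.comp, evalForm_compForm])
    (fun x => by simp [RatRep.comp, evalForm_compForm])

lemma RatRep.comp_comp {n : ℕ} (u : RatRep n) (g h : GL (Fin 2) ℂ) :
    (u.comp g).comp h = u.comp (h * g) :=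
  RatRep.ext_evalForm
    (fun x => by simp [RatRep.comp, evalForm_compForm, Matrix.vecMul_vecMul])
    (fun x => by simp [RatRep.comp, evalForm_compForm, Matrix.vecMul_vecMul])

lemma RatRep.continuous_comp {n : ℕ} (g : GL (Fin 2) ℂ) :
    Continuous fun u : RatRep n => u.comp g :=
  Continuous.subtype_mk
    (((continuous_compForm g.val).comp (continuous_fst.comp continuous_subtype_val)).prodMk
      ((continuous_compForm g.val).comp (continuous_snd.comp continuous_subtype_val))) _

/-- The orbit equivalence relation of `GL(2,ℂ)` on coprime pairs. -/
def orbitSetoid (n : ℕ) : Setoid (RatRep n) where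
  r u v := ∃ g : GL (Fin 2) ℂ, v = u.comp g
  iseqv :=
    { refl := fun u => ⟨1, u.comp_one.symm⟩
      symm := by
        rintro u _ ⟨g, rfl⟩
        exact ⟨g⁻¹, by rw [RatRep.comp_comp, inv_mul_cancel, RatRep.comp_one]⟩
      trans := by
        rintro u _ _ ⟨g, rfl⟩ ⟨h, rfl⟩
        exact ⟨h * g, RatRep.comp_comp u g h⟩ }

/-- Rescaling a pair of forms of positive degree is precomposition with a scalar matrix. -/
lemma exists_comp_of_scaleRel {n : ℕ} (hn : 1 ≤ n) {u v : RatRep n} (h : scaleRel n u v) :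
    ∃ g : GL (Fin 2) ℂ, v = u.comp g := by
  obtain ⟨c, hc⟩ := h
  obtain ⟨r, hr⟩ := IsAlgClosed.exists_pow_nat_eq (c : ℂ) hn
  have hr0 : r ≠ 0 := by
    rintro rfl
    exact c.ne_zero (by rw [← hr, zero_pow (by omega)])
  refine ⟨Units.map (algebraMap ℂ (Matrix (Fin 2) (Fin 2) ℂ)).toMonoidHom (Units.mk0 r hr0), ?_⟩
  have hv (x : Fin 2 → ℂ) :
      Matrix.vecMul x (algebraMap ℂ (Matrix (Fin 2) (Fin 2) ℂ) r) = r • x := by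
    rw [Algebra.algebraMap_eq_smul_one, Matrix.vecMul_smul, Matrix.vecMul_one]
  have h₁ : v.1.1 = (c : ℂ) • u.1.1 := congrArg Prod.fst hc
  have h₂ : v.1.2 = (c : ℂ) • u.1.2 := congrArg Prod.snd hc
  refine RatRep.ext_evalForm (fun x => ?_) (fun x => ?_)
  · simp [RatRep.comp, evalForm_compForm, hv, evalForm_smul_right, hr, h₁, evalForm_smul_left]
  · simp [RatRep.comp, evalForm_compForm, hv, evalForm_smul_right, hr, h₂, evalForm_smul_left]

/-- The class in `𝒳_n` of a coprime pair. -/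
def toXn (n : ℕ) (u : RatRep n) : Xn n := pr n (Quot.mk _ u)

lemma toXn_comp {n : ℕ} (u : RatRep n) (g : GL (Fin 2) ℂ) : toXn n (u.comp g) = toXn n u :=
  (Quot.sound ⟨u, u.comp g, g, rfl, rfl, rfl⟩).symm

lemma toXn_eq_iff {n : ℕ} (hn : 1 ≤ n) {u v : RatRep n} :
    toXn n u = toXn n v ↔ ∃ g : GL (Fin 2) ℂ, v = u.comp g := by
  refine ⟨fun h => ?_, ?_⟩
  · let F : Fn n → Quotient (orbitSetoid n) :=
      Quot.lift (Quotient.mk _) fun _ _ h => Quotient.sound (exists_comp_of_scaleRel hn h)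
    let G : Xn n → Quotient (orbitSetoid n) := Quot.lift F (by
      rintro _ _ ⟨u, v, g, rfl, rfl, h⟩
      exact Quotient.sound ⟨g, Subtype.ext h⟩)
    exact Quotient.exact (s := orbitSetoid n) (congrArg G h)
  · rintro ⟨g, rfl⟩
    exact (toXn_comp u g).symm

lemma isOpenQuotientMap_toXn {n : ℕ} (hn : 1 ≤ n) : IsOpenQuotientMap (toXn n) where
  surjective := Quot.mk_surjective.comp Quot.mk_surjective
  continuous := continuous_quot_mk.comp continuous_quot_mk
  isOpenMap U hU := by
    have hpre : toXn n ⁻¹' (toXn n '' U) =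
        ⋃ g : GL (Fin 2) ℂ, (fun u : RatRep n => u.comp g) ⁻¹' U := by
      ext u
      simp only [Set.mem_preimage, Set.mem_image, Set.mem_iUnion]
      constructor
      · rintro ⟨v, hv, h⟩
        obtain ⟨g, rfl⟩ := (toXn_eq_iff hn).1 h.symm
        exact ⟨g, hv⟩
      · rintro ⟨g, hg⟩
        exact ⟨_, hg, toXn_comp u g⟩
    have hq : IsQuotientMap (toXn n) := isQuotientMap_quot_mk.comp isQuotientMap_quot_mk
    rw [← hq.isOpen_preimage, hpre]
    exact isOpen_iUnion fun g => hU.preimage (RatRep.continuous_comp g)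

/-! ### Properness -/

/-- The size of the value of a pair of forms at a point. -/
def pairNorm {n : ℕ} (u : RatRep n) (x : Fin 2 → ℂ) : ℝ :=
  ‖evalForm u.1.1 x‖ + ‖evalForm u.1.2 x‖

lemma continuous_pairNorm {n : ℕ} :
    Continuous fun p : RatRep n × (Fin 2 → ℂ) => pairNorm p.1 p.2 := by
  have h₁ : Continuous fun p : RatRep n × (Fin 2 → ℂ) => evalForm p.1.1.1 p.2 :=
    continuous_evalForm.comp (f := fun p : RatRep n × (Fin 2 → ℂ) => (p.1.1.1, p.2))
      (by fun_prop)
  have h₂ : Continuous fun p : RatRep n × (Fin 2 → ℂ) => evalForm p.1.1.2 p.2 :=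
    continuous_evalForm.comp (f := fun p : RatRep n × (Fin 2 → ℂ) => (p.1.1.2, p.2))
      (by fun_prop)
  exact h₁.norm.add h₂.norm

lemma pairNorm_pos {n : ℕ} (u : RatRep n) {x : Fin 2 → ℂ} (hx : x ≠ 0) : 0 < pairNorm u x := by
  rcases u.2 x hx with h | h
  · exact add_pos_of_pos_of_nonneg (norm_pos_iff.2 h) (norm_nonneg _)
  · exact add_pos_of_nonneg_of_pos (norm_nonneg _) (norm_pos_iff.2 h)

lemma pairNorm_smul {n : ℕ} (u : RatRep n) (c : ℂ) (x : Fin 2 → ℂ) :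
    pairNorm u (c • x) = ‖c‖ ^ n * pairNorm u x := by
  simp [pairNorm, evalForm_smul_right, mul_add]

lemma pairNorm_comp {n : ℕ} (u : RatRep n) (g : GL (Fin 2) ℂ) (x : Fin 2 → ℂ) :
    pairNorm (u.comp g) x = pairNorm u (Matrix.vecMul x g.val) := by
  simp [pairNorm, RatRep.comp, evalForm_compForm]

/-- Near a coprime pair `u`, the value on the unit sphere is bounded above and below. -/
lemma eventually_pairNorm_bounds_sphere {n : ℕ} (u : RatRep n) :
    ∃ K : ℝ, 1 ≤ K ∧ ∀ᶠ w in 𝓝 u, ∀ x ∈ Metric.sphere (0 : Fin 2 → ℂ) 1,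
      1 < K * pairNorm w x ∧ pairNorm w x < K := by
  have hS : IsCompact (Metric.sphere (0 : Fin 2 → ℂ) 1) := isCompact_sphere 0 1
  have hpos : ∀ x ∈ Metric.sphere (0 : Fin 2 → ℂ) 1, 0 < pairNorm u x := fun x hx =>
    pairNorm_pos u (ne_zero_of_mem_unit_sphere ⟨x, hx⟩)
  have hc : Continuous (pairNorm u) := by
    have h := (continuous_pairNorm (n := n)).comp (Continuous.prodMk_right u)
    exact h
  obtain ⟨A, hA⟩ := hS.bddAbove_image hc.continuousOn
  obtain ⟨B, hB⟩ := hS.bddAbove_image (hc.continuousOn.inv₀ fun x hx => (hpos x hx).ne')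
  obtain ⟨K, hK, hAK, hBK⟩ : ∃ K : ℝ, 1 ≤ K ∧ A < K ∧ B < K :=
    ⟨max (max A B) 0 + 1, le_add_of_nonneg_left (le_max_right _ _),
      lt_add_of_le_of_pos ((le_max_left _ _).trans (le_max_left _ _)) one_pos,
      lt_add_of_le_of_pos ((le_max_right _ _).trans (le_max_left _ _)) one_pos⟩
  refine ⟨K, hK, hS.eventually_forall_of_forall_eventually fun x hx => ?_⟩
  have hlt : pairNorm u x < K := (hA (Set.mem_image_of_mem _ hx)).trans_lt hAK
  have hgt : 1 < K * pairNorm u x :=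
    (inv_lt_iff_one_lt_mul₀ (hpos x hx)).1 ((hB (Set.mem_image_of_mem _ hx)).trans_lt hBK)
  have hlim := (continuous_pairNorm (n := n)).tendsto (u, x)
  have h₁ := (hlim.const_mul K).eventually_const_lt hgt
  have h₂ := hlim.eventually_lt_const hlt
  exact h₁.and h₂

lemma pairNorm_bounds_of_sphere {n : ℕ} (hn : 1 ≤ n) {w : RatRep n} {K : ℝ}
    (hw : ∀ x ∈ Metric.sphere (0 : Fin 2 → ℂ) 1, 1 < K * pairNorm w x ∧ pairNorm w x < K)
    (x : Fin 2 → ℂ) : ‖x‖ ^ n ≤ K * pairNorm w x ∧ pairNorm w x ≤ K * ‖x‖ ^ n := by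
  by_cases hx : x = 0
  · subst hx
    have hn0 : n ≠ 0 := by omega
    have h0 : pairNorm w 0 = 0 := by
      simpa [hn0] using pairNorm_smul w 0 0
    simp [h0, hn0]
  · have hxn : 0 < ‖x‖ := norm_pos_iff.2 hx
    have hy : ((‖x‖ : ℂ)⁻¹ • x) ∈ Metric.sphere (0 : Fin 2 → ℂ) 1 := by
      simp [norm_smul, hxn.ne']
    have hscale : pairNorm w x = ‖x‖ ^ n * pairNorm w ((‖x‖ : ℂ)⁻¹ • x) := by
      have := pairNorm_smul w (‖x‖ : ℂ) ((‖x‖ : ℂ)⁻¹ • x)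
      rw [smul_inv_smul₀ (by exact_mod_cast hxn.ne')] at this
      simpa using this
    obtain ⟨h₁, h₂⟩ := hw _ hy
    have hpow : 0 < ‖x‖ ^ n := pow_pos hxn n
    rw [hscale]
    constructor <;> nlinarith

/-- Near a coprime pair `u`, the value at `x` is comparable to `‖x‖ ^ n`, uniformly. -/
lemma eventually_pairNorm_bounds {n : ℕ} (hn : 1 ≤ n) (u : RatRep n) :
    ∃ K : ℝ, 1 ≤ K ∧ ∀ᶠ w in 𝓝 u, ∀ x,
      ‖x‖ ^ n ≤ K * pairNorm w x ∧ pairNorm w x ≤ K * ‖x‖ ^ n :=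
  let ⟨K, hK, h⟩ := eventually_pairNorm_bounds_sphere u
  ⟨K, hK, h.mono fun _ hw => pairNorm_bounds_of_sphere hn hw⟩

/-- Matrices that distort norms by a factor of at most `K`. -/
def boundedDistortion (K : ℝ) : Set (Matrix (Fin 2) (Fin 2) ℂ) :=
  {M | ∀ x : Fin 2 → ℂ, ‖Matrix.vecMul x M‖ ≤ K * ‖x‖ ∧ ‖x‖ ≤ K * ‖Matrix.vecMul x M‖}

lemma isCompact_boundedDistortion (K : ℝ) : IsCompact (boundedDistortion K) := by
  have hbox : IsCompact (Set.univ.pi fun _ : Fin 2 => Set.univ.pi fun _ : Fin 2 =>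
      Metric.closedBall (0 : ℂ) K) :=
    isCompact_univ_pi fun _ => isCompact_univ_pi fun _ => isCompact_closedBall 0 K
  refine IsCompact.of_isClosed_subset (X := Matrix (Fin 2) (Fin 2) ℂ) hbox ?_ ?_
  · simp only [boundedDistortion, Set.ofPred_forall, Set.ofPred_and]
    refine isClosed_iInter fun x => ?_
    have hc : Continuous fun M : Matrix (Fin 2) (Fin 2) ℂ => Matrix.vecMul x M :=
      continuous_const.matrix_vecMul continuous_id
    exact (isClosed_le hc.norm continuous_const).inter
      (isClosed_le continuous_const (continuous_const.mul hc.norm))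
  · intro M hM i _ j _
    have h := (hM (Pi.single i 1)).1
    rw [Matrix.single_one_vecMul, Pi.norm_single, norm_one, mul_one] at h
    exact mem_closedBall_zero_iff.2 ((norm_le_pi_norm (M.row i) j).trans h)

lemma isUnit_of_mem_boundedDistortion {K : ℝ} {M : Matrix (Fin 2) (Fin 2) ℂ}
    (hM : M ∈ boundedDistortion K) : IsUnit M := by
  refine Matrix.vecMul_injective_iff_isUnit.1 fun x y hxy => ?_
  have h := (hM (x - y)).2
  rw [Matrix.sub_vecMul, sub_eq_zero.2 hxy, norm_zero, mul_zero] at h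
  exact sub_eq_zero.1 (norm_le_zero_iff.1 h)

lemma le_mul_of_pow_le_mul_pow {n : ℕ} (hn : 1 ≤ n) {K s t : ℝ} (hK : 1 ≤ K) (ht : 0 ≤ t)
    (h : s ^ n ≤ K * t ^ n) : s ≤ K * t := by
  have hK0 : 0 ≤ K := zero_le_one.trans hK
  refine le_of_pow_le_pow_left₀ (by omega : n ≠ 0) (mul_nonneg hK0 ht) (h.trans ?_)
  rw [mul_pow]
  exact mul_le_mul_of_nonneg_right (le_self_pow₀ hK (by omega)) (pow_nonneg ht n)

lemma isClosed_orbitRel {n : ℕ} (hn : 1 ≤ n) :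
    IsClosed {p : RatRep n × RatRep n | toXn n p.1 = toXn n p.2} := by
  refine IsSeqClosed.isClosed fun p q hp hpq => ?_
  obtain ⟨u, v⟩ := q
  have hu : Tendsto (fun m => (p m).1) atTop (𝓝 u) := (continuous_fst.tendsto _).comp hpq
  have hv : Tendsto (fun m => (p m).2) atTop (𝓝 v) := (continuous_snd.tendsto _).comp hpq
  choose g hg using fun m => (toXn_eq_iff hn).1 (hp m)
  obtain ⟨K, hK, hKu⟩ := eventually_pairNorm_bounds hn u
  obtain ⟨L, hL, hLv⟩ := eventually_pairNorm_bounds hn v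
  have hmem : ∀ᶠ m in atTop, (g m).val ∈ boundedDistortion (K * L) := by
    filter_upwards [hu.eventually hKu, hv.eventually hLv] with m h₁ h₂ x
    have hKL : 1 ≤ K * L := one_le_mul_of_one_le_of_one_le hK hL
    obtain ⟨ha, hb⟩ := h₁ (Matrix.vecMul x (g m).val)
    obtain ⟨hc, hd⟩ := h₂ x
    rw [hg m, pairNorm_comp] at hc hd
    refine ⟨le_mul_of_pow_le_mul_pow hn hKL (norm_nonneg _) ?_,
      le_mul_of_pow_le_mul_pow hn hKL (norm_nonneg _) ?_⟩
    · calc _ ≤ _ := ha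
        _ ≤ K * (L * ‖x‖ ^ n) := by gcongr
        _ = _ := by ring
    · calc _ ≤ _ := hc
        _ ≤ L * (K * ‖Matrix.vecMul x (g m).val‖ ^ n) := by gcongr
        _ = _ := by ring
  obtain ⟨M, hM, φ, hφ, hlim⟩ : ∃ M ∈ boundedDistortion (K * L), ∃ φ : ℕ → ℕ, StrictMono φ ∧
      Tendsto (fun m => (g (φ m)).val) atTop (𝓝 M) := by
    have : FirstCountableTopology (Matrix (Fin 2) (Fin 2) ℂ) :=
      inferInstanceAs (FirstCountableTopology (Fin 2 → Fin 2 → ℂ))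
    exact (isCompact_boundedDistortion (K * L)).tendsto_subseq' hmem.frequently
  obtain ⟨h, rfl⟩ := isUnit_of_mem_boundedDistortion hM
  have hval {f : RatRep n → Coeffs n} (hf : Continuous f)
      (hcomp : ∀ (w : RatRep n) (k : GL (Fin 2) ℂ) (x : Fin 2 → ℂ),
        evalForm (f (w.comp k)) x = evalForm (f w) (Matrix.vecMul x k.val)) (x : Fin 2 → ℂ) :
      evalForm (f v) x = evalForm (f (u.comp h)) x := by
    have hleft : Tendsto (fun m => evalForm (f (p (φ m)).2) x) atTop (𝓝 (evalForm (f v) x)) :=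
      ((hf.tendsto v).comp (hv.comp hφ.tendsto_atTop)).evalForm tendsto_const_nhds
    have hvec : Tendsto (fun m => Matrix.vecMul x (g (φ m)).val) atTop
        (𝓝 (Matrix.vecMul x h.val)) :=
      ((continuous_const.matrix_vecMul continuous_id).tendsto h.val).comp hlim
    have hright : Tendsto (fun m => evalForm (f (p (φ m)).1) (Matrix.vecMul x (g (φ m)).val))
        atTop (𝓝 (evalForm (f u) (Matrix.vecMul x h.val))) :=
      ((hf.tendsto u).comp (hu.comp hφ.tendsto_atTop)).evalForm hvec
    rw [hcomp]
    refine tendsto_nhds_unique hleft (hright.congr fun m => ?_)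
    rw [hg (φ m), hcomp]
  refine (toXn_eq_iff hn).2 ⟨h, RatRep.ext_evalForm ?_ ?_⟩
  · exact hval (f := fun w => w.1.1) (by fun_prop) fun w k x => evalForm_compForm _ _ _
  · exact hval (f := fun w => w.1.2) (by fun_prop) fun w k x => evalForm_compForm _ _ _

/-- Every convergent sequence in the moduli space `𝒳_n = F_n / PGL(2,ℂ)` has a unique
limit. -/
theorem moduli_space_unique_limits (n : ℕ) (hn : 1 ≤ n) (z : ℕ → Xn n) (l l' : Xn n)
    (hl : Tendsto z atTop (𝓝 l)) (hl' : Tendsto z atTop (𝓝 l')) : l = l' := by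
  have : T2Space (Xn n) :=
    (t2Space_iff_of_isOpenQuotientMap (isOpenQuotientMap_toXn hn)).2 (isClosed_orbitRel hn)
  exact tendsto_nhds_unique hl hl'
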